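/- arXiv:2003.14213 — 5 statements merged into one kernel-verified Lean document; each statement's English description precedes it below -/
import Mathlib

section
/- Let $B_2$, $B_3$ be Banach spaces such that the embedding $B_2 \hookrightarrow B_3$ is a continuous linear injective compact operator, and let $\beta \in (0,1)$, $p>1$ satisfy $\beta p > 1$, and $T>0$. Then every sequence $(f_n)$ of continuous functions $[0,T] \to B_2$ satisfying $\sup_n \sup_{t\in[0,T]} \|f_n(t)\|_{B_2} < \infty$ and $\sup_n \int_0^T\int_0^T \frac{\|f_n(t)-f_n(s)\|_{B_3}^p}{|t-s|^{1+\beta p}}\,dt\,ds < \infty$ admits a subsequence that converges uniformly on $[0,T]$ in the norm of $B_3$; equivalently, a set bounded in $C([0,T];B_2) \cap W^{\beta,p}([0,T];B_3)$ is relatively compact in $C([0,T];B_3)$. -/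
open MeasureTheory Filter
open scoped ENNReal NNReal Topology

/-- Young-type splitting of `x` at the level `h ^ (β - 1 / p)`. -/
lemma le_rpow_add_rpow_mul_div {x d h p β : ℝ} (hx : 0 ≤ x) (hd : 0 < d) (hdh : d ≤ h)
    (hp : 1 < p) (hβp : 1 < β * p) :
    x ≤ h ^ (β - 1 / p) + h ^ (β - 1 / p + 2) * (x ^ p / d ^ (1 + β * p)) := by
  have hh : 0 < h := hd.trans_le hdh
  rcases le_or_gt x (h ^ (β - 1 / p)) with hxh | hxh
  · exact hxh.trans (le_add_of_nonneg_right (by positivity))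
  have hx0 : 0 < x := (Real.rpow_pos_of_pos hh _).trans hxh
  have h1 : x ^ (1 - p) ≤ h ^ ((β - 1 / p) * (1 - p)) := by
    rw [Real.rpow_mul hh.le]
    exact Real.rpow_le_rpow_of_nonpos (by positivity) hxh.le (by linarith)
  have h2 : d ^ (1 + β * p) ≤ h ^ (1 + β * p) := Real.rpow_le_rpow hd.le hdh (by linarith)
  calc x = x ^ p * x ^ (1 - p) := by rw [← Real.rpow_add hx0]; simp
    _ ≤ x ^ p * h ^ ((β - 1 / p) * (1 - p)) := by gcongr
    _ = h ^ (β - 1 / p + 2) * (x ^ p / h ^ (1 + β * p)) := by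
        have : (β - 1 / p) * (1 - p) = (β - 1 / p + 2) - (1 + β * p) := by
          field_simp; ring
        rw [this, Real.rpow_sub hh]; ring
    _ ≤ h ^ (β - 1 / p + 2) * (x ^ p / d ^ (1 + β * p)) := by gcongr
    _ ≤ _ := le_add_of_nonneg_left (by positivity)

section FractionalSobolev

variable {E : Type*} [NormedAddCommGroup E] {u : ℝ → E} {T p β M : ℝ}

lemma enorm_sub_le_rpow_add_mul_div (u : ℝ → E) {s t h : ℝ} (hh : 0 < h) (hst : |s - t| ≤ h)
    (hp : 1 < p) (hβp : 1 < β * p) :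
    ‖u s - u t‖ₑ ≤ ENNReal.ofReal (h ^ (β - 1 / p)) + ENNReal.ofReal (h ^ (β - 1 / p + 2)) *
      ((‖u s - u t‖₊ : ℝ≥0∞) ^ p / ENNReal.ofReal (|s - t| ^ (1 + β * p))) := by
  rcases eq_or_ne s t with rfl | hne
  · simp
  have hd : 0 < |s - t| := abs_pos.2 (sub_ne_zero.2 hne)
  have hK : (‖u s - u t‖₊ : ℝ≥0∞) ^ p / ENNReal.ofReal (|s - t| ^ (1 + β * p))
      = ENNReal.ofReal (‖u s - u t‖ ^ p / |s - t| ^ (1 + β * p)) := by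
    rw [ENNReal.ofReal_div_of_pos (by positivity),
      ← ENNReal.ofReal_rpow_of_nonneg (norm_nonneg _) (by linarith), ofReal_norm]
    rfl
  rw [hK, ← ENNReal.ofReal_mul (by positivity), ← ENNReal.ofReal_add (by positivity) (by positivity),
    ← ofReal_norm]
  exact ENNReal.ofReal_le_ofReal (le_rpow_add_rpow_mul_div (norm_nonneg _) hd hst hp hβp)

/-- Comparison of the mean oscillations around `t` on an interval and on a subinterval of half
its length. -/
lemma half_mul_lintegral_enorm_sub_le (hu : Continuous u) (hp : 1 < p) (hβp : 1 < β * p)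
    (hw : (∫⁻ t in Set.Icc (0:ℝ) T, ∫⁻ s in Set.Icc (0:ℝ) T,
      (‖u t - u s‖₊ : ℝ≥0∞) ^ p / ENNReal.ofReal (|t - s| ^ (1 + β * p))) ≤ ENNReal.ofReal M)
    {a b h t : ℝ} (hh : 0 < h) (ha : 0 ≤ a) (haT : a + h ≤ T) (hab : a ≤ b)
    (hba : b + h / 2 ≤ a + h) :
    ENNReal.ofReal (h / 2) * ∫⁻ s in Set.Icc a (a + h), ‖u s - u t‖ₑ ≤
      ENNReal.ofReal h * (ENNReal.ofReal (h / 2) * ENNReal.ofReal (h ^ (β - 1 / p)) +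
        ∫⁻ r in Set.Icc b (b + h / 2), ‖u r - u t‖ₑ) +
      ENNReal.ofReal (h ^ (β - 1 / p + 2)) * ENNReal.ofReal M := by
  set K : ℝ → ℝ → ℝ≥0∞ := fun t s =>
    (‖u t - u s‖₊ : ℝ≥0∞) ^ p / ENNReal.ofReal (|t - s| ^ (1 + β * p))
  have hvol : ∀ c l : ℝ, (volume.restrict (Set.Icc c (c + l))) Set.univ = ENNReal.ofReal l := by
    intro c l; simp
  have hmeas : Measurable fun r => ‖u r - u t‖ₑ := by
    have : Continuous fun r => ‖u r - u t‖ₑ := by fun_prop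
    exact this.measurable
  have hJ : ∀ s ∈ Set.Icc a (a + h), ENNReal.ofReal (h / 2) * ‖u s - u t‖ₑ ≤
      (ENNReal.ofReal (h / 2) * ENNReal.ofReal (h ^ (β - 1 / p)) +
        ∫⁻ r in Set.Icc b (b + h / 2), ‖u r - u t‖ₑ) +
      ENNReal.ofReal (h ^ (β - 1 / p + 2)) * ∫⁻ r in Set.Icc b (b + h / 2), K s r := by
    intro s hs
    calc ENNReal.ofReal (h / 2) * ‖u s - u t‖ₑ
        = ∫⁻ _ in Set.Icc b (b + h / 2), ‖u s - u t‖ₑ := by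
          rw [lintegral_const, hvol, mul_comm]
      _ ≤ ∫⁻ r in Set.Icc b (b + h / 2), ((ENNReal.ofReal (h ^ (β - 1 / p)) + ‖u r - u t‖ₑ) +
            ENNReal.ofReal (h ^ (β - 1 / p + 2)) * K s r) := by
          refine setLIntegral_mono' measurableSet_Icc fun r hr => ?_
          have hsr : |s - r| ≤ h := by
            rw [abs_le]; constructor <;> linarith [hs.1, hs.2, hr.1, hr.2]
          calc ‖u s - u t‖ₑ ≤ ‖u s - u r‖ₑ + ‖u r - u t‖ₑ := by
                rw [← sub_add_sub_cancel (u s) (u r) (u t)]; exact enorm_add_le _ _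
            _ ≤ _ := by
                rw [add_right_comm]
                gcongr
                exact enorm_sub_le_rpow_add_mul_div u hh hsr hp hβp
      _ = _ := by
          rw [lintegral_add_left (by fun_prop), lintegral_add_left measurable_const,
            lintegral_const, hvol, lintegral_const_mul' _ _ ENNReal.ofReal_ne_top,
            mul_comm (ENNReal.ofReal (h / 2))]
  calc ENNReal.ofReal (h / 2) * ∫⁻ s in Set.Icc a (a + h), ‖u s - u t‖ₑ
      = ∫⁻ s in Set.Icc a (a + h), ENNReal.ofReal (h / 2) * ‖u s - u t‖ₑ :=
        (lintegral_const_mul' _ _ ENNReal.ofReal_ne_top).symm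
    _ ≤ _ := setLIntegral_mono' measurableSet_Icc hJ
    _ = ENNReal.ofReal h * (ENNReal.ofReal (h / 2) * ENNReal.ofReal (h ^ (β - 1 / p)) +
          ∫⁻ r in Set.Icc b (b + h / 2), ‖u r - u t‖ₑ) + ENNReal.ofReal (h ^ (β - 1 / p + 2)) *
          ∫⁻ s in Set.Icc a (a + h), ∫⁻ r in Set.Icc b (b + h / 2), K s r := by
        rw [lintegral_add_left measurable_const, lintegral_const, hvol,
          lintegral_const_mul' _ _ ENNReal.ofReal_ne_top, mul_comm (ENNReal.ofReal h)]
    _ ≤ _ := by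
        gcongr
        refine le_trans ?_ hw
        calc _ ≤ ∫⁻ s in Set.Icc a (a + h), ∫⁻ r in Set.Icc 0 T, K s r :=
              lintegral_mono fun s => lintegral_mono_set
                (Set.Icc_subset_Icc (ha.trans hab) (hba.trans haT))
          _ ≤ _ := lintegral_mono_set (Set.Icc_subset_Icc ha haT)

/-- The Hölder constant in the embedding `W^{β,p} ⊆ C^{0,β-1/p}` (up to a factor `2`). -/
noncomputable def fractionalSobolevConst (p β M : ℝ) : ℝ :=
  (1 + 2 * M) / (1 - 2⁻¹ ^ (β - 1 / p))

lemma sub_one_div_pos (hp : 1 < p) (hβp : 1 < β * p) : 0 < β - 1 / p := by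
  rw [sub_pos, div_lt_iff₀ (by linarith)]; exact hβp

lemma one_sub_half_rpow_pos (hp : 1 < p) (hβp : 1 < β * p) :
    0 < 1 - (2⁻¹ : ℝ) ^ (β - 1 / p) :=
  sub_pos.2 (Real.rpow_lt_one (by norm_num) (by norm_num) (sub_one_div_pos hp hβp))

lemma fractionalSobolevConst_nonneg (hp : 1 < p) (hβp : 1 < β * p) (hM : 0 ≤ M) :
    0 ≤ fractionalSobolevConst p β M :=
  div_nonneg (by positivity) (one_sub_half_rpow_pos hp hβp).le

lemma lintegral_enorm_sub_le (hu : Continuous u) (hp : 1 < p) (hβp : 1 < β * p) (hM : 0 ≤ M)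
    (hw : (∫⁻ t in Set.Icc (0:ℝ) T, ∫⁻ s in Set.Icc (0:ℝ) T,
      (‖u t - u s‖₊ : ℝ≥0∞) ^ p / ENNReal.ofReal (|t - s| ^ (1 + β * p))) ≤ ENNReal.ofReal M)
    {t ε δ : ℝ} (hε : 0 < ε) (hδ : ∀ s, |s - t| ≤ δ → ‖u s - u t‖ ≤ ε) (k : ℕ) {a h : ℝ}
    (hh : 0 < h) (hhk : h ≤ 2 ^ k * δ) (ha : 0 ≤ a) (haT : a + h ≤ T)
    (hat : a ≤ t) (hta : t ≤ a + h) :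
    ∫⁻ s in Set.Icc a (a + h), ‖u s - u t‖ₑ ≤
      ENNReal.ofReal (h * (fractionalSobolevConst p β M * h ^ (β - 1 / p) + ε)) := by
  have hA := fractionalSobolevConst_nonneg hp hβp hM
  have hA' : fractionalSobolevConst p β M * (1 - 2⁻¹ ^ (β - 1 / p)) = 1 + 2 * M :=
    div_mul_cancel₀ _ (one_sub_half_rpow_pos hp hβp).ne'
  set A := fractionalSobolevConst p β M
  induction k generalizing a h with
  | zero =>
    calc ∫⁻ s in Set.Icc a (a + h), ‖u s - u t‖ₑ
        ≤ ∫⁻ _ in Set.Icc a (a + h), ENNReal.ofReal ε := by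
          refine setLIntegral_mono' measurableSet_Icc fun s hs => ?_
          rw [← ofReal_norm]
          refine ENNReal.ofReal_le_ofReal (hδ s ?_)
          rw [abs_le]; constructor <;> linarith [hs.1, hs.2]
      _ = ENNReal.ofReal (h * ε) := by
          rw [setLIntegral_const, Real.volume_Icc, ENNReal.ofReal_mul hh.le, mul_comm]; simp
      _ ≤ _ := by
          gcongr
          exact le_add_of_nonneg_left (by positivity)
  | succ k ih =>
    have hJ := ih (a := (a + t) / 2) (h := h / 2) (by linarith)
      (by rw [pow_succ] at hhk; linarith) (by linarith) (by linarith) (by linarith) (by linarith)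
    have hI := half_mul_lintegral_enorm_sub_le (t := t) (b := (a + t) / 2) hu hp hβp hw hh ha haT
      (by linarith) (by linarith)
    have h2 : ENNReal.ofReal (h / 2) ≠ 0 := by simpa using hh
    rw [← ENNReal.mul_le_mul_iff_right h2 ENNReal.ofReal_ne_top]
    refine hI.trans ((add_le_add_left (mul_le_mul_right (add_le_add_right hJ _) _) _).trans ?_)
    rw [← ENNReal.ofReal_mul (by positivity), ← ENNReal.ofReal_add (by positivity) (by positivity),
      ← ENNReal.ofReal_mul (by positivity), ← ENNReal.ofReal_mul (by positivity),
      ← ENNReal.ofReal_add (by positivity) (by positivity), ← ENNReal.ofReal_mul (by positivity)]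
    refine ENNReal.ofReal_le_ofReal (le_of_eq ?_)
    rw [div_eq_mul_inv h 2, Real.mul_rpow hh.le (by norm_num), Real.rpow_add hh, Real.rpow_two]
    linear_combination (-(h ^ 2 * h ^ (β - 1 / p) / 2)) * hA'

/-- Morrey's inequality for the fractional Sobolev seminorm on an interval. -/
theorem norm_sub_le_of_fractional_sobolev (hu : Continuous u) (hp : 1 < p) (hβp : 1 < β * p)
    (hM : 0 ≤ M)
    (hw : (∫⁻ t in Set.Icc (0:ℝ) T, ∫⁻ s in Set.Icc (0:ℝ) T,
      (‖u t - u s‖₊ : ℝ≥0∞) ^ p / ENNReal.ofReal (|t - s| ^ (1 + β * p))) ≤ ENNReal.ofReal M)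
    {s t : ℝ} (hs : 0 ≤ s) (hst : s ≤ t) (ht : t ≤ T) :
    ‖u s - u t‖ ≤ 2 * fractionalSobolevConst p β M * (t - s) ^ (β - 1 / p) := by
  have hA := fractionalSobolevConst_nonneg hp hβp hM
  rcases hst.eq_or_lt with rfl | hlt
  · simp only [sub_self, norm_zero]; positivity
  have hh : 0 < t - s := sub_pos.2 hlt
  have key : ∀ x ∈ Set.Icc s t, ∀ ε > 0, ∫⁻ r in Set.Icc s t, ‖u r - u x‖ₑ ≤ ENNReal.ofReal
      ((t - s) * (fractionalSobolevConst p β M * (t - s) ^ (β - 1 / p) + ε)) := by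
    intro x hx ε hε
    obtain ⟨δ, hδ, hδε⟩ := Metric.continuous_iff.1 hu x ε hε
    obtain ⟨k, hk⟩ := pow_unbounded_of_one_lt ((t - s) / (δ / 2)) (one_lt_two (α := ℝ))
    have := lintegral_enorm_sub_le (t := x) (δ := δ / 2) (a := s) hu hp hβp hM hw hε
      (fun r hr => by
        rw [← dist_eq_norm]; exact (hδε r (by rw [Real.dist_eq]; linarith)).le) k hh
      ((div_le_iff₀ (by positivity)).1 hk.le) hs (by linarith) hx.1 (by linarith [hx.2])
    rwa [add_sub_cancel] at this
  refine le_of_forall_pos_le_add fun ε hε => ?_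
  have hs' := key s (Set.left_mem_Icc.2 hst) (ε / 2) (by positivity)
  have ht' := key t (Set.right_mem_Icc.2 hst) (ε / 2) (by positivity)
  have hle : ENNReal.ofReal ((t - s) * ‖u s - u t‖) ≤
      (∫⁻ r in Set.Icc s t, ‖u r - u s‖ₑ) + ∫⁻ r in Set.Icc s t, ‖u r - u t‖ₑ := by
    have hmeas : Measurable fun r => ‖u r - u s‖ₑ := by
      have : Continuous fun r => ‖u r - u s‖ₑ := by fun_prop
      exact this.measurable
    rw [← lintegral_add_left hmeas, ENNReal.ofReal_mul hh.le, ofReal_norm,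
      ← Real.volume_Icc, mul_comm, ← setLIntegral_const]
    refine lintegral_mono fun r => ?_
    rw [← sub_add_sub_cancel (u s) (u r) (u t), enorm_sub_rev (u r) (u s)]
    exact enorm_add_le _ _
  have := hle.trans (add_le_add hs' ht')
  rw [← ENNReal.ofReal_add (by positivity) (by positivity),
    ENNReal.ofReal_le_ofReal_iff (by positivity)] at this
  refine le_of_mul_le_mul_left (this.trans (le_of_eq ?_)) hh
  ring

end FractionalSobolev

/-- If `B₂ ↪ B₃` is a compact embedding and `βp > 1`, then a set bounded in
`C([0,T];B₂) ∩ W^{β,p}([0,T];B₃)` is relatively compact in `C([0,T];B₃)`: every such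
sequence has a subsequence converging uniformly on `[0,T]` in the norm of `B₃`. -/
theorem compact_embedding_C_fractional_sobolev
    {B2 B3 : Type*}
    [NormedAddCommGroup B2] [NormedSpace ℝ B2] [CompleteSpace B2]
    [NormedAddCommGroup B3] [NormedSpace ℝ B3] [CompleteSpace B3]
    (i : B2 →L[ℝ] B3) (hiinj : Function.Injective ⇑i) (hcpt : IsCompactOperator ⇑i)
    (T p β : ℝ) (hT : 0 < T) (hp : 1 < p) (hβ : β ∈ Set.Ioo (0:ℝ) 1) (hβp : 1 < β * p)
    (f : ℕ → ℝ → B2)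
    (hcont : ∀ n, ContinuousOn (f n) (Set.Icc (0:ℝ) T))
    (Cb : ℝ) (hCb : ∀ n, ∀ t ∈ Set.Icc (0:ℝ) T, ‖f n t‖ ≤ Cb)
    (Cw : ℝ≥0∞) (hCw : Cw < ⊤)
    (hw : ∀ n,
      (∫⁻ t in Set.Icc (0:ℝ) T, ∫⁻ s in Set.Icc (0:ℝ) T,
        (‖i (f n t) - i (f n s)‖₊ : ℝ≥0∞) ^ p
          / ENNReal.ofReal (|t - s| ^ (1 + β * p))) ≤ Cw) :
    ∃ φ : ℕ → ℕ, StrictMono φ ∧ ∃ g : ℝ → B3,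
      TendstoUniformlyOn (fun k t => i (f (φ k) t)) g atTop (Set.Icc (0:ℝ) T) := by
  have hc : ∀ n, Continuous ((Set.Icc (0:ℝ) T).domRestrict fun t => i (f n t)) := fun n =>
    (i.continuous.comp_continuousOn (hcont n)).domRestrict
  let F : ℕ → BoundedContinuousFunction (Set.Icc (0:ℝ) T) B3 := fun n =>
    BoundedContinuousFunction.mkOfCompact ⟨_, hc n⟩
  have hα := sub_one_div_pos hp hβp
  have hholder : ∀ n, ∀ s t : Set.Icc (0:ℝ) T, s ≤ t → ‖F n s - F n t‖ ≤
      2 * fractionalSobolevConst p β Cw.toReal * dist s t ^ (β - 1 / p) := by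
    intro n s t hst
    have hext : ∀ r ∈ Set.Icc (0:ℝ) T, Set.IccExtend hT.le (F n) r = i (f n r) := fun r hr =>
      Set.IccExtend_of_mem _ _ hr
    have := norm_sub_le_of_fractional_sobolev (u := Set.IccExtend hT.le (F n)) (T := T)
      (M := Cw.toReal) (F n).continuous.Icc_extend' hp hβp ENNReal.toReal_nonneg (by
        rw [ENNReal.ofReal_toReal hCw.ne]
        refine le_of_eq_of_le ?_ (hw n)
        refine setLIntegral_congr_fun measurableSet_Icc fun r hr => ?_
        refine setLIntegral_congr_fun measurableSet_Icc fun r' hr' => ?_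
        simp only [hext r hr, hext r' hr']) s.2.1 hst t.2.2
    rw [hext s s.2, hext t t.2] at this
    rwa [dist_comm, Subtype.dist_eq, Real.dist_eq,
      abs_of_nonneg (sub_nonneg.2 (Subtype.coe_le_coe.2 hst))]
  have hequi : UniformEquicontinuous ((↑) : Set.range F → Set.Icc (0:ℝ) T → B3) := by
    refine Metric.uniformEquicontinuous_of_continuity_modulus
      (fun d => 2 * fractionalSobolevConst p β Cw.toReal * d ^ (β - 1 / p)) ?_ _ ?_
    · have : Continuous fun d : ℝ =>
          2 * fractionalSobolevConst p β Cw.toReal * d ^ (β - 1 / p) :=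
        continuous_const.mul (Real.continuous_rpow_const hα.le)
      have h0 := this.tendsto 0
      rwa [Real.zero_rpow hα.ne', mul_zero] at h0
    · rintro s t ⟨_, n, rfl⟩
      rw [dist_eq_norm]
      rcases le_total s t with h | h
      · exact hholder n s t h
      · rw [norm_sub_rev, dist_comm]; exact hholder n t s h
  have hcomp : IsCompact (closure (Set.range F)) := by
    refine BoundedContinuousFunction.arzela_ascoli _
      (hcpt.isCompact_closure_image_closedBall Cb) _ ?_ hequi.equicontinuous
    rintro _ t ⟨n, rfl⟩
    exact subset_closure ⟨f n t, by simpa using hCb n t t.2, rfl⟩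
  obtain ⟨G, -, φ, hφ, hG⟩ := hcomp.tendsto_subseq fun n => subset_closure (Set.mem_range_self n)
  refine ⟨φ, hφ, Set.IccExtend hT.le G, ?_⟩
  rw [tendstoUniformlyOn_iff_tendstoUniformly_comp_coe]
  have hG' : Set.IccExtend hT.le G ∘ Subtype.val = G := funext fun t => Set.IccExtend_val hT.le G t
  rw [hG']
  exact BoundedContinuousFunction.tendsto_iff_tendstoUniformly.1 hG
end

section
/- Let $(Z,\mu)$ be a measure space with $\mu(Z) \le 1$, let $\delta > 0$, and let $\psi : \mathbb{R} \to [0,\infty)$ be an even measurable function with $\int_{\mathbb{R}} \psi = 1$ and $\psi = 0$ outside $[-\delta,\delta]$. Let $F : Z \times \mathbb{R} \to [0,1]$ be measurable, and let $G : Z \times \mathbb{R} \to [0,1]$ be measurable such that for each $z$ the function $\xi \mapsto G(z,\xi)$ is monotone (nondecreasing for every $z$, or nonincreasing for every $z$). Assume that $(z,\xi) \mapsto F(z,\xi) G(z,\xi)$ is integrable on $Z \times \mathbb{R}$. Then $\big| \int_Z \int_{\mathbb{R}} F(z,\xi) G(z,\xi)\, d\xi\, d\mu(z) - \int_Z \int_{\mathbb{R}}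 \int_{\mathbb{R}} F(z,\xi) G(z,\zeta)\, \psi(\xi-\zeta)\, d\zeta\, d\xi\, d\mu(z) \big| \le \delta$. -/
open MeasureTheory Filter

/-- The translation increment of a nondecreasing `[0,1]`-valued function has integral at most the
length of the translation. -/
theorem Monotone.lintegral_sub_translate_le {g : ℝ → ℝ} (hg : Monotone g)
    (h01 : ∀ x, g x ∈ Set.Icc (0 : ℝ) 1) {h : ℝ} (hh : 0 ≤ h) :
    ∫⁻ x, ENNReal.ofReal (g x - g (x - h)) ≤ ENNReal.ofReal h := by
  have hg' : Monotone fun x => g (x - h) := fun x y hxy => hg (by linarith)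
  have hnonneg : ∀ x, 0 ≤ g x - g (x - h) := fun x => sub_nonneg.2 (hg (by linarith))
  have hi : ∀ a b : ℝ, IntervalIntegrable g volume a b := fun a b => hg.intervalIntegrable
  have hi' : ∀ a b : ℝ, IntervalIntegrable (fun x => g (x - h)) volume a b :=
    fun a b => hg'.intervalIntegrable
  have hbound : ∀ n : ℕ, ∫ x in (-(n : ℝ))..n, (g x - g (x - h)) ≤ h := by
    intro n
    rw [intervalIntegral.integral_sub (hi _ _) (hi' _ _),
      intervalIntegral.integral_comp_sub_right (fun x => g x) h]
    have e1 := intervalIntegral.integral_add_adjacent_intervals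
      (hi (-(n : ℝ) - h) (-n)) (hi (-(n : ℝ)) n)
    have e2 := intervalIntegral.integral_add_adjacent_intervals
      (hi (-(n : ℝ) - h) (n - h)) (hi ((n : ℝ) - h) n)
    have l1 : 0 ≤ ∫ x in (-(n : ℝ) - h)..(-n), g x :=
      intervalIntegral.integral_nonneg (by linarith) fun x _ => (h01 x).1
    have l2 : ∫ x in ((n : ℝ) - h)..n, g x ≤ ∫ x in ((n : ℝ) - h)..n, (1 : ℝ) :=
      intervalIntegral.integral_mono_on (by linarith) (hi _ _)
        intervalIntegrable_const fun x _ => (h01 x).2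
    simp only [intervalIntegral.integral_const, smul_eq_mul] at l2
    linarith
  have hbot : Tendsto (fun n : ℕ => -(n : ℝ)) atTop atBot :=
    tendsto_neg_atTop_atBot.comp tendsto_natCast_atTop_atTop
  have hint : Integrable fun x => g x - g (x - h) := by
    refine integrable_of_intervalIntegral_norm_bounded (l := atTop)
      (a := fun n : ℕ => -(n : ℝ)) (b := fun n : ℕ => (n : ℝ)) h (fun n => ?_) hbot
      tendsto_natCast_atTop_atTop (Eventually.of_forall fun n => ?_)
    · exact ((intervalIntegrable_iff_integrableOn_Ioc_of_le
        (by linarith [n.cast_nonneg (α := ℝ)])).1 ((hi _ _).sub (hi' _ _)))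
    · simpa only [Real.norm_of_nonneg (hnonneg _)] using hbound n
  rw [← ofReal_integral_eq_lintegral_ofReal hint (Eventually.of_forall hnonneg)]
  exact ENNReal.ofReal_le_ofReal (_root_.le_of_tendsto
    (intervalIntegral_tendsto_integral hint hbot tendsto_natCast_atTop_atTop)
    (Eventually.of_forall hbound))

theorem Monotone.lintegral_enorm_sub_translate_le {g : ℝ → ℝ} (hg : Monotone g)
    (h01 : ∀ x, g x ∈ Set.Icc (0 : ℝ) 1) (h : ℝ) :
    ∫⁻ x, ‖g x - g (x - h)‖ₑ ≤ ENNReal.ofReal |h| := by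
  rcases le_total 0 h with hh | hh
  · rw [abs_of_nonneg hh]
    refine le_of_eq_of_le (lintegral_congr fun x => ?_) (hg.lintegral_sub_translate_le h01 hh)
    exact Real.enorm_of_nonneg (sub_nonneg.2 (hg (by linarith)))
  · rw [abs_of_nonpos hh, ← lintegral_add_right_eq_self _ h]
    refine le_of_eq_of_le (lintegral_congr fun x => ?_)
      (hg.lintegral_sub_translate_le h01 (neg_nonneg.2 hh))
    rw [add_sub_cancel_right, enorm_sub_rev, sub_neg_eq_add]
    exact Real.enorm_of_nonneg (sub_nonneg.2 (hg (by linarith)))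

theorem Antitone.lintegral_enorm_sub_translate_le {g : ℝ → ℝ} (hg : Antitone g)
    (h01 : ∀ x, g x ∈ Set.Icc (0 : ℝ) 1) (h : ℝ) :
    ∫⁻ x, ‖g x - g (x - h)‖ₑ ≤ ENNReal.ofReal |h| := by
  have hm : Monotone fun x => 1 - g x := fun x y hxy => sub_le_sub_left (hg hxy) 1
  refine le_of_eq_of_le (lintegral_congr fun x => ?_) (hm.lintegral_enorm_sub_translate_le
    (fun x => ⟨sub_nonneg.2 (h01 x).2, sub_le_self _ (h01 x).1⟩) h)
  rw [sub_sub_sub_cancel_left, enorm_sub_rev]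

/-- `L¹` mollification error for a `[0,1]`-valued function `g` whose translates satisfy
`‖g - g(· - h)‖₁ ≤ |h|`, tested against a `[0,1]`-valued function `f`. -/
theorem lintegral_enorm_mul_sub_mollification_le {δ : ℝ} {ψ f g : ℝ → ℝ}
    (hψmeas : Measurable ψ) (hψnonneg : ∀ x, 0 ≤ ψ x) (hψint : (∫ x : ℝ, ψ x) = 1)
    (hψsupp : ∀ x : ℝ, x ∉ Set.Icc (-δ) δ → ψ x = 0)
    (hf01 : ∀ x, f x ∈ Set.Icc (0 : ℝ) 1)
    (hgmeas : Measurable g) (hg01 : ∀ x, g x ∈ Set.Icc (0 : ℝ) 1)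
    (hg : ∀ h, ∫⁻ x, ‖g x - g (x - h)‖ₑ ≤ ENNReal.ofReal |h|) :
    ∫⁻ x, ‖f x * g x - ∫ y, f x * g y * ψ (x - y)‖ₑ ≤ ENNReal.ofReal δ := by
  have hψ : Integrable ψ := Integrable.of_integral_ne_zero (by rw [hψint]; exact one_ne_zero)
  have hψone : ∫⁻ h, ‖ψ h‖ₑ = 1 := by
    simp_rw [fun h => Real.enorm_of_nonneg (hψnonneg h)]
    rw [← ofReal_integral_eq_lintegral_ofReal hψ (Eventually.of_forall hψnonneg), hψint,
      ENNReal.ofReal_one]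
  have hpt : ∀ x, ‖f x * g x - ∫ y, f x * g y * ψ (x - y)‖ₑ ≤
      ∫⁻ h, ‖ψ h‖ₑ * ‖g x - g (x - h)‖ₑ := by
    intro x
    have hgψ : Integrable fun h => g (x - h) * ψ h := by
      refine hψ.bdd_mul (c := 1) (hgmeas.comp (measurable_const.sub measurable_id)).aestronglyMeasurable
        (Eventually.of_forall fun h => ?_)
      rw [Real.norm_of_nonneg (hg01 _).1]
      exact (hg01 _).2
    have e : f x * g x - ∫ y, f x * g y * ψ (x - y) =
        f x * ∫ h, ψ h * (g x - g (x - h)) := by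
      rw [← integral_sub_left_eq_self (fun y => f x * g y * ψ (x - y)) volume x]
      simp only [sub_sub_cancel, mul_assoc, mul_sub]
      rw [integral_const_mul, integral_sub (hψ.mul_const _) (by simpa only [mul_comm] using hgψ),
        integral_mul_const, hψint]
      simp only [mul_comm (ψ _)]
      ring
    rw [e, enorm_mul]
    have hf1 : ‖f x‖ₑ ≤ 1 := by
      rw [Real.enorm_of_nonneg (hf01 x).1]
      exact ENNReal.ofReal_le_one.2 (hf01 x).2
    calc ‖f x‖ₑ * ‖∫ h, ψ h * (g x - g (x - h))‖ₑ
        ≤ 1 * ‖∫ h, ψ h * (g x - g (x - h))‖ₑ := by gcongr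
      _ ≤ ∫⁻ h, ‖ψ h‖ₑ * ‖g x - g (x - h)‖ₑ := by
        rw [one_mul]
        simpa only [enorm_mul] using
          enorm_integral_le_lintegral_enorm fun h => ψ h * (g x - g (x - h))
  calc ∫⁻ x, ‖f x * g x - ∫ y, f x * g y * ψ (x - y)‖ₑ
      ≤ ∫⁻ x, ∫⁻ h, ‖ψ h‖ₑ * ‖g x - g (x - h)‖ₑ := lintegral_mono hpt
    _ = ∫⁻ h, ∫⁻ x, ‖ψ h‖ₑ * ‖g x - g (x - h)‖ₑ :=
      lintegral_lintegral_swap (by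
        apply Measurable.aemeasurable
        unfold Function.uncurry
        fun_prop)
    _ ≤ ∫⁻ h, ‖ψ h‖ₑ * ENNReal.ofReal δ := by
      refine lintegral_mono fun h => ?_
      dsimp only
      rw [lintegral_const_mul _ (by fun_prop)]
      by_cases hh : h ∈ Set.Icc (-δ) δ
      · gcongr
        exact (hg h).trans (ENNReal.ofReal_le_ofReal (abs_le.2 hh))
      · simp [hψsupp h hh]
    _ = ENNReal.ofReal δ := by
      rw [lintegral_mul_const _ (by fun_prop), hψone, one_mul]

/-- Mollification error estimate in the velocity variable (doubling of variables):
if `μ(Z) ≤ 1`, `ψ` is an even nonnegative mollifier supported in `[-δ,δ]` with unit mass,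
`F, G : Z × ℝ → [0,1]` are measurable with `G(z,·)` monotone, and `F·G` is integrable,
then the mollified double integral differs from the diagonal one by at most `δ`. -/
theorem mollification_error_estimate {Z : Type*} [MeasurableSpace Z]
    (μ : Measure Z) (hμ : μ Set.univ ≤ 1)
    (δ : ℝ) (hδ : 0 < δ) (ψ : ℝ → ℝ)
    (hψmeas : Measurable ψ) (hψnonneg : ∀ x, 0 ≤ ψ x) (hψeven : ∀ x, ψ (-x) = ψ x)
    (hψint : (∫ x : ℝ, ψ x) = 1) (hψsupp : ∀ x : ℝ, x ∉ Set.Icc (-δ) δ → ψ x = 0)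
    (F G : Z → ℝ → ℝ)
    (hFmeas : Measurable (Function.uncurry F))
    (hF01 : ∀ z ξ, F z ξ ∈ Set.Icc (0:ℝ) 1)
    (hGmeas : Measurable (Function.uncurry G))
    (hG01 : ∀ z ξ, G z ξ ∈ Set.Icc (0:ℝ) 1)
    (hGmono : (∀ z, Monotone (G z)) ∨ (∀ z, Antitone (G z)))
    (hFG : Integrable (fun q : Z × ℝ => F q.1 q.2 * G q.1 q.2) (μ.prod volume)) :
    |(∫ z, (∫ ξ : ℝ, F z ξ * G z ξ) ∂μ) -
        ∫ z, (∫ ξ : ℝ, ∫ ζ : ℝ, F z ξ * G z ζ * ψ (ξ - ζ)) ∂μ| ≤ δ := by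
  have : IsFiniteMeasure μ := ⟨hμ.trans_lt ENNReal.one_lt_top⟩
  have hMmeas : StronglyMeasurable fun q : Z × ℝ => ∫ ζ, F q.1 q.2 * G q.1 ζ * ψ (q.2 - ζ) := by
    refine StronglyMeasurable.integral_prod_right'
      (f := fun p : (Z × ℝ) × ℝ => F p.1.1 p.1.2 * G p.1.1 p.2 * ψ (p.1.2 - p.2))
      (Measurable.stronglyMeasurable ?_)
    have h1 : Measurable fun p : (Z × ℝ) × ℝ => F p.1.1 p.1.2 := hFmeas.comp measurable_fst
    have h2 : Measurable fun p : (Z × ℝ) × ℝ => G p.1.1 p.2 :=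
      hGmeas.comp (measurable_fst.fst.prodMk measurable_snd)
    fun_prop
  set D : Z × ℝ → ℝ := fun q =>
    F q.1 q.2 * G q.1 q.2 - ∫ ζ, F q.1 q.2 * G q.1 ζ * ψ (q.2 - ζ) with hD
  have hDmeas : AEStronglyMeasurable D (μ.prod volume) :=
    hFG.aestronglyMeasurable.sub hMmeas.aestronglyMeasurable
  have hDz : ∀ z, ∫⁻ ξ, ‖D (z, ξ)‖ₑ ≤ ENNReal.ofReal δ := fun z =>
    lintegral_enorm_mul_sub_mollification_le hψmeas hψnonneg hψint hψsupp (hF01 z)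
      (hGmeas.comp measurable_prodMk_left) (hG01 z) (hGmono.elim
        (fun h => (h z).lintegral_enorm_sub_translate_le (hG01 z))
        (fun h => (h z).lintegral_enorm_sub_translate_le (hG01 z)))
  have hDtotal : ∫⁻ q, ‖D q‖ₑ ∂(μ.prod volume) ≤ ENNReal.ofReal δ := by
    rw [lintegral_prod _ hDmeas.enorm]
    calc ∫⁻ z, (∫⁻ ξ, ‖D (z, ξ)‖ₑ) ∂μ ≤ ∫⁻ _, ENNReal.ofReal δ ∂μ := lintegral_mono hDz
      _ ≤ ENNReal.ofReal δ := by
        rw [lintegral_const]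
        exact mul_le_of_le_one_right' hμ
  have hDint : Integrable D (μ.prod volume) := ⟨hDmeas, hDtotal.trans_lt ENNReal.ofReal_lt_top⟩
  have hMint : Integrable (fun q : Z × ℝ => ∫ ζ, F q.1 q.2 * G q.1 ζ * ψ (q.2 - ζ))
      (μ.prod volume) := by
    refine (hFG.sub hDint).congr (Eventually.of_forall fun q => ?_)
    simp [hD]
  rw [← integral_prod _ hFG, ← integral_prod _ hMint, ← integral_sub hFG hMint,
    ← ENNReal.ofReal_le_ofReal_iff hδ.le, ← Real.enorm_eq_ofReal_abs]
  exact (enorm_integral_le_lintegral_enorm _).trans hDtotal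
end

section
/- Let $G : \mathbb{R} \to \mathbb{R}$ be nondecreasing and bounded, with limits $G(-\infty) := \lim_{\xi \to -\infty} G(\xi)$ and $G(+\infty) := \lim_{\xi \to +\infty} G(\xi)$. Then for every $c \ge 0$, the function $\xi \mapsto G(\xi) - G(\xi - c)$ is nonnegative and integrable on $\mathbb{R}$, and $\int_{\mathbb{R}} \big( G(\xi) - G(\xi - c) \big)\, d\xi = c \, \big( G(+\infty) - G(-\infty) \big)$. -/
open MeasureTheory Filter

/-- The integral of a monotone function over `[x - c, x]` converges to `c * L` along any filter
along which both `G x` and `G (x - c)` converge to `L`. -/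
theorem Monotone.tendsto_intervalIntegral_sub {G : ℝ → ℝ} (hmono : Monotone G) {l : Filter ℝ}
    {c L : ℝ} (hc : 0 ≤ c) (h : Tendsto G l (nhds L))
    (h' : Tendsto (fun x => G (x - c)) l (nhds L)) :
    Tendsto (fun x => ∫ t in (x - c)..x, G t) l (nhds (c * L)) := by
  refine tendsto_of_tendsto_of_tendsto_of_le_of_le (h'.const_mul c) (h.const_mul c) ?_ ?_
  · intro x
    have key := intervalIntegral.integral_mono_on (μ := volume) (sub_le_self x hc)
      (intervalIntegrable_const (c := G (x - c))) hmono.intervalIntegrable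
      (fun t ht => hmono ht.1)
    simpa using key
  · intro x
    have key := intervalIntegral.integral_mono_on (μ := volume) (sub_le_self x hc)
      hmono.intervalIntegrable (intervalIntegrable_const (c := G x))
      (fun t ht => hmono ht.2)
    simpa using key

/-- Shift identity for bounded nondecreasing functions: if `G` is nondecreasing with
limits `a` at `-∞` and `b` at `+∞`, then for every `c ≥ 0` the function
`ξ ↦ G ξ - G (ξ - c)` is nonnegative and integrable, with integral `c * (b - a)`. -/
theorem integral_shift_monotone (G : ℝ → ℝ) (hmono : Monotone G) (a b : ℝ)
    (ha : Tendsto G atBot (nhds a)) (hb : Tendsto G atTop (nhds b))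
    (c : ℝ) (hc : 0 ≤ c) :
    (∀ ξ : ℝ, 0 ≤ G ξ - G (ξ - c)) ∧
    Integrable (fun ξ : ℝ => G ξ - G (ξ - c)) ∧
    (∫ ξ : ℝ, (G ξ - G (ξ - c))) = c * (b - a) := by
  have hnonneg : ∀ ξ : ℝ, 0 ≤ G ξ - G (ξ - c) :=
    fun ξ => sub_nonneg.2 (hmono (sub_le_self ξ hc))
  have hint : ∀ x y : ℝ, IntervalIntegrable G volume x y := fun _ _ => hmono.intervalIntegrable
  have hshift : ∀ x y : ℝ, IntervalIntegrable (fun ξ => G (ξ - c)) volume x y := fun _ _ =>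
    Monotone.intervalIntegrable fun _ _ hst => hmono (sub_le_sub_right hst c)
  have hlim : Tendsto (fun R : ℝ => ∫ ξ in (-R)..R, (G ξ - G (ξ - c))) atTop
      (nhds (c * (b - a))) := by
    have htop := hmono.tendsto_intervalIntegral_sub hc hb
      (hb.comp (tendsto_atTop_add_const_right atTop (-c) tendsto_id))
    have hbot := hmono.tendsto_intervalIntegral_sub hc ha
      (ha.comp (tendsto_atBot_add_const_right atBot (-c) tendsto_id))
    rw [mul_sub]
    refine (htop.sub (hbot.comp tendsto_neg_atTop_atBot)).congr fun R => ?_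
    rw [intervalIntegral.integral_sub (hint _ _) (hshift _ _),
      intervalIntegral.integral_comp_sub_right,
      intervalIntegral.integral_interval_sub_interval_comm' (hint _ _) (hint _ _) (hint _ _)]
    rfl
  have hintegrable : Integrable (fun ξ : ℝ => G ξ - G (ξ - c)) := by
    refine integrable_of_intervalIntegral_norm_tendsto (c * (b - a))
      (fun R => ((hint (-R) R).sub (hshift (-R) R)).1) tendsto_neg_atTop_atBot tendsto_id ?_
    simpa only [Real.norm_of_nonneg (hnonneg _)] using hlim
  exact ⟨hnonneg, hintegrable, tendsto_nhds_unique
    (intervalIntegral_tendsto_integral hintegrable tendsto_neg_atTop_atBot tendsto_id) hlim⟩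
end

section
/- Let $\mu$ and $\nu$ be Borel probability measures on $\mathbb{R}$ with finite first moments, i.e. $\int_{\mathbb{R}} |r| \, d\mu(r) < \infty$ and $\int_{\mathbb{R}} |r| \, d\nu(r) < \infty$. Then $\int_{\mathbb{R}}\int_{\mathbb{R}} |\xi - \zeta| \, d\mu(\xi)\, d\nu(\zeta) = \int_{\mathbb{R}} \big[ \mu((\xi,\infty))\, \nu((-\infty,\xi]) + \mu((-\infty,\xi])\, \nu((\xi,\infty)) \big] \, d\xi$, and all quantities are finite. -/
open MeasureTheory

/-- The layer-cake identity behind the kinetic formulation, in `ℝ≥0∞`. -/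
theorem lintegral_abs_sub_prod_eq (μ ν : Measure ℝ) [SFinite μ] [SFinite ν] :
    ∫⁻ q : ℝ × ℝ, ENNReal.ofReal |q.1 - q.2| ∂(μ.prod ν)
      = ∫⁻ t : ℝ, (μ (Set.Ioi t) * ν (Set.Iic t) + μ (Set.Iic t) * ν (Set.Ioi t)) := by
  let S : Set (ℝ × ℝ × ℝ) := {p | min p.2.1 p.2.2 ≤ p.1 ∧ p.1 < max p.2.1 p.2.2}
  have hS : MeasurableSet S := by
    have hle : MeasurableSet {p : ℝ × ℝ × ℝ | min p.2.1 p.2.2 ≤ p.1} :=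
      measurableSet_le (by fun_prop) (by fun_prop)
    have hlt : MeasurableSet {p : ℝ × ℝ × ℝ | p.1 < max p.2.1 p.2.2} :=
      measurableSet_lt (by fun_prop) (by fun_prop)
    exact hle.inter hlt
  have hleft := Measure.prod_apply (μ := (volume : Measure ℝ)) (ν := μ.prod ν) hS
  have hright := Measure.prod_apply_symm (μ := (volume : Measure ℝ)) (ν := μ.prod ν) hS
  calc
    _ = ∫⁻ q : ℝ × ℝ, volume ((fun t => (t, q)) ⁻¹' S) ∂(μ.prod ν) := by
      refine lintegral_congr fun q => ?_
      have : (fun t => (t, q)) ⁻¹' S = Set.Ico (min q.1 q.2) (max q.1 q.2) := rfl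
      rw [this, Real.volume_Ico, max_sub_min_eq_abs']
    _ = ∫⁻ t : ℝ, (μ.prod ν) (Prod.mk t ⁻¹' S) := hright.symm.trans hleft
    _ = _ := by
      refine lintegral_congr fun t => ?_
      have : Prod.mk t ⁻¹' S
          = Set.Ioi t ×ˢ Set.Iic t ∪ Set.Iic t ×ˢ Set.Ioi t := by
        ext ⟨x, y⟩
        simp only [S, Set.mem_preimage, Set.mem_ofPred_eq, Set.mem_union, Set.mem_prod,
          Set.mem_Ioi, Set.mem_Iic, min_le_iff, lt_max_iff]
        grind
      rw [this, measure_union _ (measurableSet_Iic.prod measurableSet_Ioi),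
        Measure.prod_prod, Measure.prod_prod]
      exact Set.disjoint_prod.2 (Or.inl (Set.Iic_disjoint_Ioi le_rfl).symm)

/-- For Borel probability measures `μ`, `ν` on `ℝ` with finite first moments,
`∫∫ |ξ - ζ| dμ(ξ) dν(ζ) = ∫ [μ((ξ,∞)) ν((-∞,ξ]) + μ((-∞,ξ]) ν((ξ,∞))] dξ`,
and all quantities are finite. -/
theorem abs_diff_integral_eq_kinetic (μ ν : Measure ℝ)
    [IsProbabilityMeasure μ] [IsProbabilityMeasure ν]
    (hμ : Integrable (fun r : ℝ => |r|) μ) (hν : Integrable (fun r : ℝ => |r|) ν) :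
    Integrable (fun q : ℝ × ℝ => |q.1 - q.2|) (μ.prod ν) ∧
    Integrable (fun ξ : ℝ =>
      (μ (Set.Ioi ξ)).toReal * (ν (Set.Iic ξ)).toReal
        + (μ (Set.Iic ξ)).toReal * (ν (Set.Ioi ξ)).toReal) ∧
    (∫ ζ : ℝ, ∫ ξ : ℝ, |ξ - ζ| ∂μ ∂ν)
      = ∫ ξ : ℝ, ((μ (Set.Ioi ξ)).toReal * (ν (Set.Iic ξ)).toReal
          + (μ (Set.Iic ξ)).toReal * (ν (Set.Ioi ξ)).toReal) := by
  have hμ' : Integrable (fun r : ℝ => r) μ :=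
    (integrable_norm_iff measurable_id.aestronglyMeasurable).1 hμ
  have hν' : Integrable (fun r : ℝ => r) ν :=
    (integrable_norm_iff measurable_id.aestronglyMeasurable).1 hν
  have hprod : Integrable (fun q : ℝ × ℝ => |q.1 - q.2|) (μ.prod ν) :=
    ((hμ'.comp_fst ν).sub (hν'.comp_snd μ)).abs
  let G : ℝ → ENNReal := fun t => μ (Set.Ioi t) * ν (Set.Iic t) + μ (Set.Iic t) * ν (Set.Ioi t)
  have hIoi (ρ : Measure ℝ) : Measurable fun t => ρ (Set.Ioi t) :=
    Antitone.measurable fun _ _ h => measure_mono (Set.Ioi_subset_Ioi h)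
  have hIic (ρ : Measure ℝ) : Measurable fun t => ρ (Set.Iic t) :=
    Monotone.measurable fun _ _ h => measure_mono (Set.Iic_subset_Iic.2 h)
  have hG : Measurable G :=
    ((hIoi μ).mul (hIic ν)).add ((hIic μ).mul (hIoi ν))
  have hG_int : ∫⁻ t, G t ≠ ⊤ := by
    rw [← lintegral_abs_sub_prod_eq]
    exact hprod.lintegral_lt_top.ne
  have hG_toReal : (fun ξ : ℝ => (μ (Set.Ioi ξ)).toReal * (ν (Set.Iic ξ)).toReal
      + (μ (Set.Iic ξ)).toReal * (ν (Set.Ioi ξ)).toReal) = fun ξ => (G ξ).toReal := by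
    ext ξ
    rw [ENNReal.toReal_add (by finiteness) (by finiteness), ENNReal.toReal_mul,
      ENNReal.toReal_mul]
  rw [hG_toReal]
  refine ⟨hprod, integrable_toReal_of_lintegral_ne_top hG.aemeasurable hG_int, ?_⟩
  rw [← integral_prod_symm _ hprod, integral_toReal hG.aemeasurable
    (ae_lt_top hG hG_int), ← lintegral_abs_sub_prod_eq,
    integral_eq_lintegral_of_nonneg_ae (.of_forall fun _ => abs_nonneg _)
      hprod.aestronglyMeasurable]
end

section
/- Let $\mathbb{T}^N$ be the $N$-dimensional torus and let $\nu^1, \nu^2$ be measurable maps from $\mathbb{T}^N$ to Borel probability measures on $\mathbb{R}$ such that $\int_{\mathbb{T}^N}\int_{\mathbb{R}} |\xi| \, d\nu^i_x(\xi)\, dx < \infty$ for $i=1,2$. Define $f_i(x,\xi) := \nu^i_x((\xi,\infty))$ and $\bar f_i := 1 - f_i$. For $\gamma, \delta > 0$, let $\rho_\gamma : \mathbb{T}^N \to [0,\infty)$ be measurable with $\int_{\mathbb{T}^N} \rho_\gamma = 1$ and $\rho_\gamma = 0$ outside the ball of radius $\gamma$ centered at $0$, and let $\psi_\delta : \mathbb{R}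 \to [0,\infty)$ be even with $\int_{\mathbb{R}} \psi_\delta = 1$ and $\psi_\delta = 0$ outside $[-\delta,\delta]$. Then, as $(\gamma,\delta) \to (0,0)$, $\int_{(\mathbb{T}^N)^2}\int_{\mathbb{R}^2} \rho_\gamma(x-y)\, \psi_\delta(\xi-\zeta)\, \big( f_1(x,\xi) \bar f_2(y,\zeta) + \bar f_1(x,\xi) f_2(y,\zeta) \big) \, d\xi\, d\zeta\, dx\, dy$ converges to $\int_{\mathbb{T}^N}\int_{\mathbb{R}} \big( f_1(x,\xi) \bar f_2(x,\xi) + \bar f_1(x,\xi) f_2(x,\xi) \big) \, d\xi\, dx$; i.e. the error term $\mathcal{E}(\gamma,\delta)$, defined as the difference of these two quantities, tends to $0$. -/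
open MeasureTheory Filter
open scoped ENNReal Topology

instance UnitAddCircle.isProbabilityMeasure_volume :
    IsProbabilityMeasure (volume : Measure UnitAddCircle) :=
  ⟨by simp⟩

/-- Continuity of translations in `L¹`. -/
lemma tendsto_lintegral_enorm_translate_sub {G : Type*} [AddCommGroup G] [TopologicalSpace G]
    [IsTopologicalAddGroup G] [MeasurableSpace G] [BorelSpace G] (μ : Measure G)
    [IsLocallyFiniteMeasure μ] [μ.InnerRegularCompactLTTop] [μ.IsAddLeftInvariant]
    {g : G → ℝ} (hg : Integrable g μ) :
    Tendsto (fun r : G => ∫⁻ p, ‖g (p - r) - g p‖ₑ ∂μ) (𝓝 0) (𝓝 0) := by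
  have : Fact ((1 : ℝ≥0∞) ≠ ∞) := ⟨ENNReal.one_ne_top⟩
  have hm : MemLp g 1 μ := memLp_one_iff_integrable.2 hg
  have hc : Continuous fun r : G => DomAddAct.mk (-r) +ᵥ hm.toLp g :=
    (DomAddAct.continuous_mk.comp continuous_neg).vadd continuous_const
  have ht := (hc.edist (continuous_const (y := hm.toLp g))).tendsto 0
  simp only [neg_zero, DomAddAct.mk_zero, zero_vadd, edist_self] at ht
  refine ht.congr fun r => ?_
  rw [DomAddAct.mk_vadd_toLp, Lp.edist_toLp_toLp, eLpNorm_one_eq_lintegral_enorm]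
  simp [sub_eq_neg_add, add_comm]

lemma lintegral_enorm_indicator_Iio_sub_le (a b : ℝ) :
    ∫⁻ ξ, ‖(Set.Iio a).indicator (1 : ℝ → ℝ) ξ - (Set.Iio b).indicator 1 ξ‖ₑ ≤ ‖a - b‖ₑ := by
  calc _ ≤ ∫⁻ ξ, (Set.uIcc b a).indicator (1 : ℝ → ℝ≥0∞) ξ := by
        refine lintegral_mono fun ξ => ?_
        by_cases hξ : ξ ∈ Set.uIcc b a
        · rw [Set.indicator_of_mem hξ]
          simp only [Set.indicator_apply, Set.mem_Iio, Pi.one_apply]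
          split_ifs <;> simp
        · rw [Set.mem_uIcc] at hξ
          have : ξ < a ↔ ξ < b := by grind
          simp [Set.indicator_apply, this]
    _ = ‖a - b‖ₑ := by
        rw [lintegral_indicator_one measurableSet_uIcc, Real.volume_interval,
          ← Real.norm_eq_abs, ofReal_norm]

/-- The kinetic function of a family of measures on the real line. -/
noncomputable def kineticFunction {T : Type*} (ν : T → Measure ℝ) (p : T × ℝ) : ℝ :=
  (ν p.1 (Set.Ioi p.2)).toReal

section kinetic
variable {T : Type*} {ν : T → Measure ℝ}

lemma kineticFunction_nonneg (p : T × ℝ) : 0 ≤ kineticFunction ν p := ENNReal.toReal_nonneg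

lemma kineticFunction_le_one (hν : ∀ x, IsProbabilityMeasure (ν x)) (p : T × ℝ) :
    kineticFunction ν p ≤ 1 := by
  have := hν p.1
  exact measureReal_le_one

lemma enorm_one_sub_two_mul_kineticFunction_le_one (hν : ∀ x, IsProbabilityMeasure (ν x))
    (p : T × ℝ) : ‖1 - 2 * kineticFunction ν p‖ₑ ≤ 1 := by
  have h0 := kineticFunction_nonneg (ν := ν) p
  have h1 := kineticFunction_le_one hν p
  rw [← ofReal_norm, ENNReal.ofReal_le_one, Real.norm_eq_abs, abs_le]
  constructor <;> linarith

variable [MeasurableSpace T]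

lemma measurable_kineticFunction (hν : ∀ x, IsProbabilityMeasure (ν x))
    (hm : ∀ B : Set ℝ, MeasurableSet B → Measurable fun x => ν x B) :
    Measurable (kineticFunction ν) := by
  let κ : ProbabilityTheory.Kernel T ℝ := ⟨ν, Measure.measurable_of_measurable_coe _ hm⟩
  have : ProbabilityTheory.IsMarkovKernel κ := ⟨hν⟩
  have hS : MeasurableSet {z : (T × ℝ) × ℝ | z.1.2 < z.2} :=
    measurableSet_lt (by fun_prop) (by fun_prop)
  exact (ProbabilityTheory.Kernel.measurable_kernel_prodMk_left
    (κ := κ.comap Prod.fst measurable_fst) hS).ennreal_toReal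

lemma integrable_kineticFunction_sub (μ : Measure T) [SFinite μ]
    (hν : ∀ x, IsProbabilityMeasure (ν x))
    (hm : ∀ B : Set ℝ, MeasurableSet B → Measurable fun x => ν x B)
    (hmom : (∫⁻ x, ∫⁻ ξ, (‖ξ‖₊ : ℝ≥0∞) ∂(ν x) ∂μ) < ⊤) :
    Integrable (fun p : T × ℝ => kineticFunction ν p - (Set.Iio (0 : ℝ)).indicator 1 p.2)
      (μ.prod volume) := by
  have hmeas : Measurable fun p : T × ℝ =>
      kineticFunction ν p - (Set.Iio (0 : ℝ)).indicator 1 p.2 :=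
    (measurable_kineticFunction hν hm).sub
      ((measurable_one.indicator measurableSet_Iio).comp measurable_snd)
  refine ⟨hmeas.aestronglyMeasurable, ?_⟩
  rw [hasFiniteIntegral_iff_enorm, lintegral_prod _ hmeas.enorm.aemeasurable]
  refine lt_of_le_of_lt (lintegral_mono fun x => ?_) hmom
  have := hν x
  have hjoint : Measurable fun z : ℝ × ℝ =>
      (Set.Iio z.2).indicator (1 : ℝ → ℝ) z.1 - (Set.Iio 0).indicator 1 z.1 := by
    refine Measurable.sub ?_ ((measurable_one.indicator measurableSet_Iio).comp measurable_fst)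
    have hS : MeasurableSet {z : ℝ × ℝ | z.1 < z.2} :=
      measurableSet_lt measurable_fst measurable_snd
    exact (measurable_const (a := (1 : ℝ))).indicator hS
  have hint (ξ : ℝ) : Integrable (fun u => (Set.Iio u).indicator (1 : ℝ → ℝ) ξ) (ν x) :=
    ((integrable_const (1 : ℝ)).indicator measurableSet_Ioi : Integrable
      ((Set.Ioi ξ).indicator fun _ => (1 : ℝ)) (ν x))
  have hf (ξ : ℝ) : kineticFunction ν (x, ξ) = ∫ u, (Set.Iio u).indicator (1 : ℝ → ℝ) ξ ∂(ν x) :=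
    (integral_indicator_one measurableSet_Ioi).symm
  calc ∫⁻ ξ, ‖kineticFunction ν (x, ξ) - (Set.Iio (0 : ℝ)).indicator 1 ξ‖ₑ
      ≤ ∫⁻ ξ, ∫⁻ u, ‖(Set.Iio u).indicator (1 : ℝ → ℝ) ξ - (Set.Iio 0).indicator 1 ξ‖ₑ ∂(ν x) := by
        refine lintegral_mono fun ξ => ?_
        have : kineticFunction ν (x, ξ) - (Set.Iio (0 : ℝ)).indicator 1 ξ =
            ∫ u, ((Set.Iio u).indicator (1 : ℝ → ℝ) ξ - (Set.Iio 0).indicator 1 ξ) ∂(ν x) := by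
          rw [integral_sub (hint ξ) (integrable_const _), hf]
          simp
        rw [this]
        exact enorm_integral_le_lintegral_enorm _
    _ = ∫⁻ u, (∫⁻ ξ, ‖(Set.Iio u).indicator (1 : ℝ → ℝ) ξ - (Set.Iio 0).indicator 1 ξ‖ₑ) ∂(ν x) :=
        lintegral_lintegral_swap hjoint.enorm.aemeasurable
    _ ≤ ∫⁻ u, (‖u‖₊ : ℝ≥0∞) ∂(ν x) :=
        lintegral_mono fun u => by
          rw [← enorm_eq_nnnorm]
          exact (lintegral_enorm_indicator_Iio_sub_le u 0).trans_eq (by rw [sub_zero])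

end kinetic

section prod

variable {T : Type*} [MeasurableSpace T]

lemma tendsto_lintegral_enorm_kineticFunction_translate_sub [AddCommGroup T] [TopologicalSpace T]
    [IsTopologicalAddGroup T] [BorelSpace T] [SecondCountableTopology T] (μ : Measure T)
    [IsProbabilityMeasure μ] [μ.IsAddLeftInvariant]
    [(μ.prod (volume : Measure ℝ)).InnerRegularCompactLTTop]
    {ν : T → Measure ℝ} (hν : ∀ x, IsProbabilityMeasure (ν x))
    (hm : ∀ B : Set ℝ, MeasurableSet B → Measurable fun x => ν x B)
    (hmom : (∫⁻ x, ∫⁻ ξ, (‖ξ‖₊ : ℝ≥0∞) ∂(ν x) ∂μ) < ⊤) :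
    Tendsto (fun r : T × ℝ =>
        ∫⁻ p, ‖kineticFunction ν (p - r) - kineticFunction ν p‖ₑ ∂(μ.prod volume))
      (𝓝 0) (𝓝 0) := by
  set χ : ℝ → ℝ := (Set.Iio (0 : ℝ)).indicator 1 with hχ
  have hχm : Measurable χ := measurable_one.indicator measurableSet_Iio
  have hg := integrable_kineticFunction_sub μ hν hm hmom
  have ht := tendsto_lintegral_enorm_translate_sub (μ.prod (volume : Measure ℝ)) hg
  have h2 : Tendsto (fun r : T × ℝ => ‖r.2‖ₑ) (𝓝 0) (𝓝 0) := by
    simpa using (continuous_snd.enorm (X := T × ℝ) (f := Prod.snd)).tendsto 0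
  have h3 := ht.add h2
  rw [add_zero] at h3
  refine tendsto_of_tendsto_of_tendsto_of_le_of_le tendsto_const_nhds h3
    (fun _ => zero_le) fun r => ?_
  have hmeas : Measurable fun p : T × ℝ => ‖χ (p.2 - r.2) - χ p.2‖ₑ := by fun_prop
  have key : ∫⁻ p : T × ℝ, ‖χ (p.2 - r.2) - χ p.2‖ₑ ∂(μ.prod volume) ≤ ‖r.2‖ₑ := by
    rw [lintegral_prod _ hmeas.aemeasurable]
    simp only [lintegral_const, measure_univ, mul_one]
    refine le_trans (le_of_eq ?_) ((lintegral_enorm_indicator_Iio_sub_le r.2 0).trans_eq (by simp))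
    refine lintegral_congr fun ξ => ?_
    simp [hχ, Set.indicator_apply, sub_neg]
  refine le_trans ?_ (add_le_add_right key _)
  rw [← lintegral_add_right _ hmeas]
  refine lintegral_mono fun p => ?_
  refine le_trans (le_of_eq ?_) (enorm_add_le _ _)
  congr 1
  simp only [Prod.snd_sub]
  ring

lemma lintegral_lintegral_translate {G : Type*} [AddCommGroup G] [MeasurableSpace G]
    [MeasurableAdd₂ G] [MeasurableNeg G] (μ : Measure G) [SFinite μ] [μ.IsAddLeftInvariant]
    [μ.IsNegInvariant] {k : G → ℝ≥0∞} (hk : Measurable k) {D : G → G → ℝ≥0∞}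
    (hD : Measurable (Function.uncurry D)) :
    ∫⁻ p, ∫⁻ q, k (p - q) * D p q ∂μ ∂μ = ∫⁻ r, k r * ∫⁻ p, D p (p - r) ∂μ ∂μ := by
  have hD' : Measurable fun z : G × G => D z.1 (z.1 - z.2) :=
    hD.comp (measurable_fst.prodMk (measurable_fst.sub measurable_snd))
  calc ∫⁻ p, ∫⁻ q, k (p - q) * D p q ∂μ ∂μ
      = ∫⁻ p, ∫⁻ r, k r * D p (p - r) ∂μ ∂μ := by
        refine lintegral_congr fun p => ?_
        rw [← lintegral_sub_left_eq_self (fun q => k (p - q) * D p q) p]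
        simp
    _ = ∫⁻ r, ∫⁻ p, k r * D p (p - r) ∂μ ∂μ :=
        lintegral_lintegral_swap ((hk.comp measurable_snd).mul hD').aemeasurable
    _ = _ := by
        refine lintegral_congr fun r => ?_
        rw [lintegral_const_mul]
        exact hD'.comp (measurable_id.prodMk measurable_const)

lemma measurePreserving_prodProdProdComm {α β γ δ : Type*} [MeasurableSpace α] [MeasurableSpace β]
    [MeasurableSpace γ] [MeasurableSpace δ] (a : Measure α) (b : Measure β) (c : Measure γ)
    (d : Measure δ) [SFinite a] [SFinite b] [SFinite c] [SFinite d] :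
    MeasurePreserving (fun z : α × (β × (γ × δ)) => ((z.1, z.2.2.1), (z.2.1, z.2.2.2)))
      (a.prod (b.prod (c.prod d))) ((a.prod c).prod (b.prod d)) := by
  have h1 := (measurePreserving_prodAssoc b c d).symm
  have h2 : MeasurePreserving _ ((b.prod c).prod d) ((c.prod b).prod d) :=
    (Measure.measurePreserving_swap (μ := b) (ν := c)).prod (MeasurePreserving.id d)
  have h3 := measurePreserving_prodAssoc c b d
  have h4 := (MeasurePreserving.id a).prod (h3.comp (h2.comp h1))
  exact ((measurePreserving_prodAssoc a c (b.prod d)).symm).comp h4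

lemma integral_prod_prod_eq_iterated {S : Type*} [MeasurableSpace S] (μ : Measure T) (l : Measure S)
    [SFinite μ] [SFinite l] {K : (T × S) × (T × S) → ℝ}
    (hK : Integrable K ((μ.prod l).prod (μ.prod l))) :
    ∫ x, ∫ y, ∫ ξ, ∫ ζ, K ((x, ξ), (y, ζ)) ∂l ∂l ∂μ ∂μ = ∫ z, K z ∂((μ.prod l).prod (μ.prod l)) := by
  have hmp := measurePreserving_prodProdProdComm μ μ l l
  have hi := hmp.integrable_comp_of_integrable hK
  rw [← hmp.map_eq, integral_map hmp.measurable.aemeasurable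
    (by rw [hmp.map_eq]; exact hK.aestronglyMeasurable)]
  refine Eq.trans ?_ (integral_prod _ hi).symm
  refine integral_congr_ae ?_
  filter_upwards [hi.prod_right_ae] with x hx
  rw [integral_prod _ hx]
  refine integral_congr_ae ?_
  filter_upwards [hx.prod_right_ae] with y hy
  exact (integral_prod _ hy).symm

end prod

section comparison

variable {G : Type*} [AddCommGroup G] [MeasurableSpace G] [MeasurableAdd₂ G] [MeasurableNeg G]
  {μ : Measure G} [SFinite μ] [μ.IsAddLeftInvariant] [μ.IsNegInvariant]

lemma integrable_mollifier_mul_fst {k : G → ℝ} (hk : Measurable k) (hki : Integrable k μ)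
    {b : G → ℝ} (hbm : Measurable b) (hb : Integrable b μ) :
    Integrable (fun z : G × G => k (z.1 - z.2) * b z.1) (μ.prod μ) := by
  have hm : Measurable fun z : G × G => k (z.1 - z.2) * b z.1 := by fun_prop
  refine ⟨hm.aestronglyMeasurable, ?_⟩
  rw [hasFiniteIntegral_iff_enorm, lintegral_prod _ hm.enorm.aemeasurable]
  simp only [enorm_mul]
  rw [lintegral_lintegral_translate μ hk.enorm (D := fun p _ => ‖b p‖ₑ)
    (hbm.comp measurable_fst).enorm, lintegral_mul_const _ hk.enorm]
  exact ENNReal.mul_lt_top hki.2 hb.2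

lemma integral_mollifier_mul_fst {k : G → ℝ} (hk : Measurable k) (hki : Integrable k μ)
    (hk1 : ∫ r, k r ∂μ = 1) {b : G → ℝ} (hbm : Measurable b) (hb : Integrable b μ) :
    ∫ z : G × G, k (z.1 - z.2) * b z.1 ∂(μ.prod μ) = ∫ p, b p ∂μ := by
  rw [integral_prod _ (integrable_mollifier_mul_fst hk hki hbm hb)]
  refine integral_congr_ae (Eventually.of_forall fun p => ?_)
  simp only [integral_mul_const, integral_sub_left_eq_self k μ p, hk1, one_mul]

/-- Mollifying `A` with a probability density whose support only sees translations under which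
`A` moves by at most `ε` in `L¹` changes the integral of its diagonal by at most `ε`. -/
lemma integrable_and_enorm_integral_mollifier_sub_le {k : G → ℝ} (hk : Measurable k)
    (hki : Integrable k μ) (hk0 : ∀ r, 0 ≤ k r) (hk1 : ∫ r, k r ∂μ = 1) {A : G → G → ℝ}
    (hA : Measurable (Function.uncurry A)) (hdiag : Integrable (fun p => A p p) μ) {ε : ℝ≥0∞}
    (hε : ε ≠ ∞) (h : ∀ r, k r ≠ 0 → ∫⁻ p, ‖A p (p - r) - A p p‖ₑ ∂μ ≤ ε) :
    Integrable (fun z : G × G => k (z.1 - z.2) * A z.1 z.2) (μ.prod μ) ∧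
      ‖(∫ z : G × G, k (z.1 - z.2) * A z.1 z.2 ∂(μ.prod μ)) - ∫ p, A p p ∂μ‖ₑ ≤ ε := by
  have hdm : Measurable fun p => A p p := hA.comp (measurable_id.prodMk measurable_id)
  have hA' : Measurable fun z : G × G => A z.1 z.2 := hA
  have hDm : Measurable fun z : G × G => A z.1 z.2 - A z.1 z.1 :=
    hA'.sub (hdm.comp measurable_fst)
  have hm : Measurable fun z : G × G => k (z.1 - z.2) * (A z.1 z.2 - A z.1 z.1) :=
    (hk.comp (measurable_fst.sub measurable_snd)).mul hDm
  have hk1' : ∫⁻ r, ‖k r‖ₑ ∂μ = 1 := by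
    have := ofReal_integral_norm_eq_lintegral_enorm hki
    simp only [Real.norm_of_nonneg (hk0 _), hk1, ENNReal.ofReal_one] at this
    exact this.symm
  have hle : ∫⁻ z : G × G, ‖k (z.1 - z.2) * (A z.1 z.2 - A z.1 z.1)‖ₑ ∂(μ.prod μ) ≤ ε := by
    rw [lintegral_prod _ hm.enorm.aemeasurable]
    simp only [enorm_mul]
    rw [lintegral_lintegral_translate μ hk.enorm (D := fun p q => ‖A p q - A p p‖ₑ) hDm.enorm]
    calc _ ≤ ∫⁻ r, ‖k r‖ₑ * ε ∂μ := by
          refine lintegral_mono fun r => ?_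
          by_cases hr : k r = 0
          · simp [hr]
          · exact mul_le_mul_right (h r hr) _
      _ = ε := by rw [lintegral_mul_const _ hk.enorm, hk1', one_mul]
  have hi : Integrable (fun z : G × G => k (z.1 - z.2) * (A z.1 z.2 - A z.1 z.1)) (μ.prod μ) :=
    ⟨hm.aestronglyMeasurable, hle.trans_lt hε.lt_top⟩
  have hi0 := integrable_mollifier_mul_fst hk hki hdm hdiag
  have hi1 : Integrable (fun z : G × G => k (z.1 - z.2) * A z.1 z.2) (μ.prod μ) := by
    refine (hi.add hi0).congr (Eventually.of_forall fun z => ?_)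
    simp only [Pi.add_apply]
    ring
  refine ⟨hi1, ?_⟩
  rw [← integral_mollifier_mul_fst hk hki hk1 hdm hdiag, ← integral_sub hi1 hi0]
  simp only [← mul_sub]
  exact (enorm_integral_le_lintegral_enorm _).trans hle

end comparison

/-- The integrand `f₁ f̄₂ + f̄₁ f₂` with `f₁` evaluated at `p` and `f₂` at `q`. -/
noncomputable def kruzkovIntegrand {T : Type*} (ν₁ ν₂ : T → Measure ℝ) (p q : T × ℝ) : ℝ :=
  kineticFunction ν₁ p * (1 - kineticFunction ν₂ q)
    + (1 - kineticFunction ν₁ p) * kineticFunction ν₂ q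

section kruzkov

variable {T : Type*} {ν₁ ν₂ : T → Measure ℝ}

lemma enorm_kruzkovIntegrand_sub_le (hν₁ : ∀ x, IsProbabilityMeasure (ν₁ x)) (p q q' : T × ℝ) :
    ‖kruzkovIntegrand ν₁ ν₂ p q - kruzkovIntegrand ν₁ ν₂ p q'‖ₑ ≤
      ‖kineticFunction ν₂ q - kineticFunction ν₂ q'‖ₑ := by
  have : kruzkovIntegrand ν₁ ν₂ p q - kruzkovIntegrand ν₁ ν₂ p q' =
      (1 - 2 * kineticFunction ν₁ p) * (kineticFunction ν₂ q - kineticFunction ν₂ q') := by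
    simp only [kruzkovIntegrand]
    ring
  rw [this, enorm_mul]
  exact mul_le_of_le_one_left' (enorm_one_sub_two_mul_kineticFunction_le_one hν₁ p)

variable [MeasurableSpace T]

lemma measurable_kruzkovIntegrand
    (hν₁ : ∀ x, IsProbabilityMeasure (ν₁ x)) (hν₂ : ∀ x, IsProbabilityMeasure (ν₂ x))
    (hm₁ : ∀ B : Set ℝ, MeasurableSet B → Measurable fun x => ν₁ x B)
    (hm₂ : ∀ B : Set ℝ, MeasurableSet B → Measurable fun x => ν₂ x B) :
    Measurable (Function.uncurry (kruzkovIntegrand ν₁ ν₂)) := by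
  have h₁ := measurable_kineticFunction hν₁ hm₁
  have h₂ := measurable_kineticFunction hν₂ hm₂
  simp only [Function.uncurry_def, kruzkovIntegrand]
  fun_prop

lemma integrable_kruzkovIntegrand_diag (μ : Measure T) [SFinite μ]
    (hν₁ : ∀ x, IsProbabilityMeasure (ν₁ x)) (hν₂ : ∀ x, IsProbabilityMeasure (ν₂ x))
    (hm₁ : ∀ B : Set ℝ, MeasurableSet B → Measurable fun x => ν₁ x B)
    (hm₂ : ∀ B : Set ℝ, MeasurableSet B → Measurable fun x => ν₂ x B)
    (hmom₁ : (∫⁻ x, ∫⁻ ξ, (‖ξ‖₊ : ℝ≥0∞) ∂(ν₁ x) ∂μ) < ⊤)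
    (hmom₂ : (∫⁻ x, ∫⁻ ξ, (‖ξ‖₊ : ℝ≥0∞) ∂(ν₂ x) ∂μ) < ⊤) :
    Integrable (fun p => kruzkovIntegrand ν₁ ν₂ p p) (μ.prod volume) := by
  refine ((integrable_kineticFunction_sub μ hν₁ hm₁ hmom₁).norm.add
    (integrable_kineticFunction_sub μ hν₂ hm₂ hmom₂).norm).mono'
    ((measurable_kruzkovIntegrand hν₁ hν₂ hm₁ hm₂).comp
      (measurable_id.prodMk measurable_id)).aestronglyMeasurable
    (Eventually.of_forall fun p => ?_)
  have h1 := kineticFunction_nonneg (ν := ν₁) p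
  have h2 := kineticFunction_le_one hν₁ p
  have h3 := kineticFunction_nonneg (ν := ν₂) p
  have h4 := kineticFunction_le_one hν₂ p
  simp only [Pi.add_apply, Real.norm_eq_abs, kruzkovIntegrand, Set.indicator_apply, Pi.one_apply]
  rw [abs_of_nonneg (by nlinarith [mul_nonneg h1 (sub_nonneg.2 h4)])]
  split_ifs
  · rw [abs_of_nonpos (by linarith), abs_of_nonpos (by linarith)]
    nlinarith [mul_nonneg (sub_nonneg.2 h2) (sub_nonneg.2 h4)]
  · rw [sub_zero, sub_zero, abs_of_nonneg h1, abs_of_nonneg h3]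
    nlinarith [mul_nonneg h1 h3]

end kruzkov

/-- The mollified functional converges to the diagonal one over any second countable locally compact
normed group with an invariant probability measure. -/
theorem tendsto_integral_mollified_kruzkovIntegrand {T : Type*} [NormedAddCommGroup T]
    [MeasurableSpace T] [BorelSpace T] [SecondCountableTopology T] [LocallyCompactSpace T]
    (μ : Measure T) [IsProbabilityMeasure μ] [μ.IsAddHaarMeasure]
    (ν₁ ν₂ : T → Measure ℝ)
    (hprob₁ : ∀ x, IsProbabilityMeasure (ν₁ x))
    (hprob₂ : ∀ x, IsProbabilityMeasure (ν₂ x))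
    (hmeas₁ : ∀ B : Set ℝ, MeasurableSet B → Measurable fun x => ν₁ x B)
    (hmeas₂ : ∀ B : Set ℝ, MeasurableSet B → Measurable fun x => ν₂ x B)
    (hmom₁ : (∫⁻ x, ∫⁻ ξ, (‖ξ‖₊ : ℝ≥0∞) ∂(ν₁ x) ∂μ) < ⊤)
    (hmom₂ : (∫⁻ x, ∫⁻ ξ, (‖ξ‖₊ : ℝ≥0∞) ∂(ν₂ x) ∂μ) < ⊤)
    (ρ : ℝ → T → ℝ) (ψ : ℝ → ℝ → ℝ)
    (hρ : ∀ γ : ℝ, 0 < γ →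
      Measurable (ρ γ) ∧ (∀ x, 0 ≤ ρ γ x) ∧ ((∫ x, ρ γ x ∂μ) = 1) ∧
      (∀ x, x ∉ Metric.ball (0 : T) γ → ρ γ x = 0))
    (hψ : ∀ δ : ℝ, 0 < δ →
      Measurable (ψ δ) ∧ (∀ r, 0 ≤ ψ δ r) ∧ ((∫ r : ℝ, ψ δ r) = 1) ∧
      (∀ r : ℝ, r ∉ Set.Icc (-δ) δ → ψ δ r = 0)) :
    Tendsto (fun q : ℝ × ℝ =>
        ∫ x, ∫ y, ∫ ξ : ℝ, ∫ ζ : ℝ, ρ q.1 (x - y) * ψ q.2 (ξ - ζ) *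
          kruzkovIntegrand ν₁ ν₂ (x, ξ) (y, ζ) ∂volume ∂volume ∂μ ∂μ)
      ((𝓝[>] (0:ℝ)) ×ˢ (𝓝[>] (0:ℝ)))
      (𝓝 (∫ x, ∫ ξ : ℝ, kruzkovIntegrand ν₁ ν₂ (x, ξ) (x, ξ) ∂volume ∂μ)) := by
  have hdiag := integrable_kruzkovIntegrand_diag μ hprob₁ hprob₂ hmeas₁ hmeas₂ hmom₁ hmom₂
  rw [← integral_prod (fun p => kruzkovIntegrand ν₁ ν₂ p p) hdiag, tendsto_iff_edist_tendsto_0,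
    ENNReal.tendsto_nhds_zero]
  intro ε hε
  wlog hεtop : ε ≠ ∞ generalizing ε
  · rw [not_not.1 hεtop]
    exact Eventually.of_forall fun _ => le_top
  have htr := tendsto_lintegral_enorm_kineticFunction_translate_sub μ hprob₂ hmeas₂ hmom₂
  obtain ⟨η, hη, hball⟩ := Metric.eventually_nhds_iff_ball.1 (ENNReal.tendsto_nhds_zero.1 htr ε hε)
  have hsmall : ∀ᶠ s in 𝓝[>] (0 : ℝ), s ∈ Set.Ioo 0 η := Ioo_mem_nhdsGT hη
  filter_upwards [hsmall.prod_mk hsmall] with q ⟨hγ, hδ⟩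
  obtain ⟨hρm, hρ0, hρ1, hρs⟩ := hρ q.1 hγ.1
  obtain ⟨hψm, hψ0, hψ1, hψs⟩ := hψ q.2 hδ.1
  have hρi : Integrable (ρ q.1) μ := integrable_of_integral_eq_one hρ1
  have hψi : Integrable (ψ q.2) := integrable_of_integral_eq_one hψ1
  obtain ⟨hint, hle⟩ := integrable_and_enorm_integral_mollifier_sub_le
    (μ := μ.prod (volume : Measure ℝ))
    (k := fun r => ρ q.1 r.1 * ψ q.2 r.2) (by fun_prop) (hρi.mul_prod hψi)
    (fun r => mul_nonneg (hρ0 _) (hψ0 _)) (by rw [integral_prod_mul, hρ1, hψ1, one_mul])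
    (measurable_kruzkovIntegrand hprob₁ hprob₂ hmeas₁ hmeas₂) hdiag hεtop (fun r hr => by
      refine (lintegral_mono fun p => enorm_kruzkovIntegrand_sub_le hprob₁ p _ _).trans
        (hball r ?_)
      have h1 : r.1 ∈ Metric.ball 0 q.1 := by
        by_contra h
        exact hr (by rw [hρs _ h, zero_mul])
      have h2 : r.2 ∈ Set.Icc (-q.2) q.2 := by
        by_contra h
        exact hr (by rw [hψs _ h, mul_zero])
      rw [Metric.mem_ball, Prod.dist_eq, max_lt_iff]
      refine ⟨(Metric.mem_ball.1 h1).trans hγ.2, ?_⟩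
      rw [Prod.snd_zero, Real.dist_0_eq_abs]
      exact (abs_le.2 h2).trans_lt hδ.2)
  rw [edist_eq_enorm_sub]
  rw [← integral_prod_prod_eq_iterated _ _ hint] at hle
  exact hle

/-- Convergence of the doubled (mollified) Kruzkov functional to the diagonal one:
for kinetic functions `f_i(x,ξ) = ν^i_x((ξ,∞))` of Young measures on the torus with
finite first moments, the mollified integral
`∫∫∫∫ ρ_γ(x-y) ψ_δ(ξ-ζ) (f₁(x,ξ) f̄₂(y,ζ) + f̄₁(x,ξ) f₂(y,ζ))`
tends to `∫∫ (f₁ f̄₂ + f̄₁ f₂)(x,ξ)` as `(γ,δ) → (0,0)`. -/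
theorem mollified_kruzkov_functional_tendsto (N : ℕ)
    (ν₁ ν₂ : (Fin N → UnitAddCircle) → Measure ℝ)
    (hprob₁ : ∀ x, IsProbabilityMeasure (ν₁ x))
    (hprob₂ : ∀ x, IsProbabilityMeasure (ν₂ x))
    (hmeas₁ : ∀ B : Set ℝ, MeasurableSet B → Measurable fun x => ν₁ x B)
    (hmeas₂ : ∀ B : Set ℝ, MeasurableSet B → Measurable fun x => ν₂ x B)
    (hmom₁ : (∫⁻ x, ∫⁻ ξ, (‖ξ‖₊ : ℝ≥0∞) ∂(ν₁ x)) < ⊤)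
    (hmom₂ : (∫⁻ x, ∫⁻ ξ, (‖ξ‖₊ : ℝ≥0∞) ∂(ν₂ x)) < ⊤)
    (ρ : ℝ → (Fin N → UnitAddCircle) → ℝ) (ψ : ℝ → ℝ → ℝ)
    (hρ : ∀ γ : ℝ, 0 < γ →
      Measurable (ρ γ) ∧ (∀ x, 0 ≤ ρ γ x) ∧ ((∫ x, ρ γ x) = 1) ∧
      (∀ x, x ∉ Metric.ball (0 : Fin N → UnitAddCircle) γ → ρ γ x = 0))
    (hψ : ∀ δ : ℝ, 0 < δ →
      Measurable (ψ δ) ∧ (∀ r, 0 ≤ ψ δ r) ∧ (∀ r, ψ δ (-r) = ψ δ r) ∧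
      ((∫ r : ℝ, ψ δ r) = 1) ∧ (∀ r : ℝ, r ∉ Set.Icc (-δ) δ → ψ δ r = 0)) :
    Tendsto (fun q : ℝ × ℝ =>
        ∫ x, ∫ y, ∫ ξ : ℝ, ∫ ζ : ℝ,
          ρ q.1 (x - y) * ψ q.2 (ξ - ζ) *
            ((ν₁ x (Set.Ioi ξ)).toReal * (1 - (ν₂ y (Set.Ioi ζ)).toReal)
              + (1 - (ν₁ x (Set.Ioi ξ)).toReal) * (ν₂ y (Set.Ioi ζ)).toReal))
      ((𝓝[>] (0:ℝ)) ×ˢ (𝓝[>] (0:ℝ)))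
      (𝓝 (∫ x, ∫ ξ : ℝ,
          ((ν₁ x (Set.Ioi ξ)).toReal * (1 - (ν₂ x (Set.Ioi ξ)).toReal)
            + (1 - (ν₁ x (Set.Ioi ξ)).toReal) * (ν₂ x (Set.Ioi ξ)).toReal))) := by
  exact tendsto_integral_mollified_kruzkovIntegrand volume ν₁ ν₂ hprob₁ hprob₂ hmeas₁ hmeas₂
    hmom₁ hmom₂ ρ ψ hρ
    fun δ hδ => ⟨(hψ δ hδ).1, (hψ δ hδ).2.1, (hψ δ hδ).2.2.2⟩
end
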